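/- arXiv:1611.00411 — 2 statements merged into one kernel-verified Lean document; each statement's English description precedes it below -/
import Mathlib

section
/- Let s : V → ℤ be a sandpile on a locally finite connected graph. If there exists a stabilizing sequence for s, then there exists a sequence that is both legal and stabilizing for s. -/
/-- Toppling vertex `x`: `x` loses `deg x` particles and each neighbor gains one. -/
def SimpleGraph.topple {V : Type*} [DecidableEq V] (G : SimpleGraph V) [G.LocallyFinite]
    (s : V → ℤ) (x : V) : V → ℤ :=
  fun v => s v + (if v ∈ G.neighborFinset x then 1 else 0) - (if v = x then (G.degree x : ℤ) else 0)

/-- A sequence of vertices is legal for `s` if each vertex is unstable at the time it is toppled. -/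
def SimpleGraph.Legal {V : Type*} [DecidableEq V] (G : SimpleGraph V) [G.LocallyFinite]
    (s : V → ℤ) (l : List V) : Prop :=
  ∀ i : Fin l.length, (G.degree (l.get i) : ℤ) ≤ (l.take i).foldl (G.topple) s (l.get i)

/-- A sequence of vertices is stabilizing for `s` if the resulting configuration is stable. -/
def SimpleGraph.Stabilizing {V : Type*} [DecidableEq V] (G : SimpleGraph V) [G.LocallyFinite]
    (s : V → ℤ) (l : List V) : Prop :=
  ∀ v, l.foldl (G.topple) s v ≤ (G.degree v : ℤ) - 1

namespace SimpleGraph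

variable {V : Type*} [DecidableEq V] (G : SimpleGraph V) [G.LocallyFinite]

instance rightCommutative_topple : RightCommutative G.topple where
  right_comm s x y := by
    funext v
    simp only [topple]
    ring

/-- Toppling only other vertices never decreases the value at `v`. -/
lemma le_foldl_topple_of_notMem (s : V → ℤ) {l : List V} {v : V} (hv : v ∉ l) :
    s v ≤ l.foldl G.topple s v := by
  induction l generalizing s with
  | nil => exact le_rfl
  | cons x l ih =>
    rw [List.mem_cons, not_or] at hv
    refine le_trans ?_ (ih (G.topple s x) hv.2)
    simp only [topple, if_neg hv.1]
    split_ifs <;> simp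

variable {G}

lemma Stabilizing.mem_of_degree_le {s : V → ℤ} {l : List V} (hl : G.Stabilizing s l) {v : V}
    (hv : (G.degree v : ℤ) ≤ s v) : v ∈ l := by
  by_contra hmem
  have h₁ := G.le_foldl_topple_of_notMem s hmem
  have h₂ := hl v
  linarith

lemma Stabilizing.erase {s : V → ℤ} {l : List V} (hl : G.Stabilizing s l) {v : V} (hv : v ∈ l) :
    G.Stabilizing (G.topple s v) (l.erase v) := by
  intro w
  have h := hl w
  rwa [(List.perm_cons_erase hv).foldl_eq s, List.foldl_cons] at h

lemma Legal.cons {s : V → ℤ} {v : V} {l : List V} (hv : (G.degree v : ℤ) ≤ s v)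
    (hl : G.Legal (G.topple s v) l) : G.Legal s (v :: l) := by
  intro i
  refine Fin.cases ?_ (fun j => ?_) i
  · exact hv
  · exact hl j

end SimpleGraph

/-- If there exists a stabilizing sequence for a sandpile `s` on a locally finite connected
graph, then there exists a sequence that is both legal and stabilizing for `s`. -/
theorem exists_legal_stabilizing {V : Type*} [DecidableEq V] (G : SimpleGraph V)
    [G.LocallyFinite] (hconn : G.Connected) (s : V → ℤ)
    (h : ∃ y : List V, G.Stabilizing s y) :
    ∃ l : List V, G.Legal s l ∧ G.Stabilizing s l := by
  obtain ⟨y, hy⟩ := h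
  induction hn : y.length generalizing s y with
  | zero =>
    rw [List.length_eq_zero_iff] at hn
    subst hn
    exact ⟨[], fun i => i.elim0, hy⟩
  | succ n ih =>
    by_cases hs : ∃ v, (G.degree v : ℤ) ≤ s v
    · obtain ⟨v, hv⟩ := hs
      have hmem := hy.mem_of_degree_le hv
      obtain ⟨l, hlegal, hstab⟩ := ih (G.topple s v) (y.erase v) (hy.erase hmem)
        (by rw [List.length_erase_of_mem hmem, hn, Nat.add_sub_cancel])
      exact ⟨v :: l, hlegal.cons hv, hstab⟩
    · push Not at hs
      exact ⟨[], fun i => i.elim0, fun v => Int.le_sub_one_of_lt (hs v)⟩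
end

section
/- If f : ℤ^d → ℝ is nonnegative with f(0) = 0 and |Δf| ≤ 1 on the lattice ball of radius 2r around the origin (r > 1), then there is a constant A_0 depending only on d such that f(x) ≤ A_0|x|² for all lattice points x with |x| ≤ r. -/
/-- The lattice `ℤᵈ`. -/
abbrev Vd (d : ℕ) := Fin d → ℤ

/-- The neighbor of `x` in direction `j = (i, b)`: `x + eᵢ` if `b`, else `x − eᵢ`. -/
def nbr {d : ℕ} (x : Vd d) (j : Fin d × Bool) : Vd d :=
  if j.2 then x + Pi.single j.1 1 else x - Pi.single j.1 1

/-- The graph Laplacian on `ℤᵈ`: `Δf(x) = Σ_{y ∼ x} (f(y) − f(x))`. -/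
def lapd {d : ℕ} (f : Vd d → ℝ) (x : Vd d) : ℝ :=
  ∑ j : Fin d × Bool, (f (nbr x j) - f x)

/-- The squared Euclidean norm of a lattice point, as a real number. -/
def rnorm2 {d : ℕ} (x : Vd d) : ℝ := ∑ i, ((x i : ℝ)) ^ 2

theorem nbr_apply {d : ℕ} (x : Vd d) (j : Fin d × Bool) (i : Fin d) :
    nbr x j i = x i + if i = j.1 then (if j.2 then 1 else -1) else 0 := by
  obtain ⟨k, b⟩ := j
  by_cases h : i = k
  · subst h
    cases b <;> simp [nbr, sub_eq_add_neg]
  · cases b <;> simp [nbr, h]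

theorem nbr_add {d : ℕ} (x v : Vd d) (j : Fin d × Bool) : nbr (x + v) j = nbr x j + v := by
  ext i
  simp only [nbr_apply, Pi.add_apply]
  ring

theorem nbr_nbr_not {d : ℕ} (x : Vd d) (i : Fin d) (b : Bool) : nbr (nbr x (i, b)) (i, !b) = x := by
  ext k
  simp only [nbr_apply]
  by_cases h : k = i <;> cases b <;> simp [h]

theorem lapd_eq {d : ℕ} (f : Vd d → ℝ) (x : Vd d) :
    lapd f x = (∑ j : Fin d × Bool, f (nbr x j)) - 2 * d * f x := by
  simp only [lapd, Finset.sum_sub_distrib, Finset.sum_const, Finset.card_univ, Fintype.card_prod,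
    Fintype.card_fin, Fintype.card_bool, nsmul_eq_mul]
  push_cast
  ring

theorem lapd_translate {d : ℕ} (f : Vd d → ℝ) (z v : Vd d) :
    lapd (fun y => f (y + z)) v = lapd f (v + z) := by
  simp [lapd, nbr_add]

/-- Summation by parts for the lattice Laplacian. -/
theorem sum_mul_lapd {d : ℕ} (S : Finset (Vd d)) (f u : Vd d → ℝ)
    (hu : ∀ y, u y ≠ 0 → y ∈ S ∧ ∀ j, nbr y j ∈ S) :
    ∑ y ∈ S, f y * lapd u y = ∑ y ∈ S, u y * lapd f y := by
  have shift : ∀ (i : Fin d) (b : Bool),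
      ∑ y ∈ S, f y * u (nbr y (i, b)) = ∑ y ∈ S, u y * f (nbr y (i, !b)) := by
    intro i b
    refine Finset.sum_bij_ne_zero (fun y _ _ => nbr y (i, b)) ?_ ?_ ?_ ?_
    · intro y _ hne
      exact (hu _ (right_ne_zero_of_mul hne)).1
    · intro y _ _ y' _ _ h
      rw [← nbr_nbr_not y i b, h, nbr_nbr_not]
    · intro y _ hne
      refine ⟨nbr y (i, !b), (hu _ (left_ne_zero_of_mul hne)).2 _, ?_, ?_⟩
      · have := nbr_nbr_not y i (!b)
        rw [Bool.not_not] at this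
        rw [this, mul_comm]
        exact hne
      · have := nbr_nbr_not y i (!b)
        rwa [Bool.not_not] at this
    · intro y _ _
      rw [nbr_nbr_not, mul_comm]
  simp only [lapd_eq, mul_sub, Finset.sum_sub_distrib, Finset.mul_sum]
  congr 1
  · rw [Finset.sum_comm, Finset.sum_comm (s := S), Fintype.sum_prod_type, Fintype.sum_prod_type]
    refine Finset.sum_congr rfl fun i _ => ?_
    simp only [Fintype.sum_bool, shift]
    simp [add_comm]
  · exact Finset.sum_congr rfl fun y _ => by ring

/-- The lattice cube of side `2n + 1` centred at the origin. -/
noncomputable def cube (d n : ℕ) : Finset (Vd d) := Fintype.piFinset fun _ => Finset.Icc (-(n : ℤ)) n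

theorem mem_cube {d n : ℕ} {y : Vd d} : y ∈ cube d n ↔ ∀ i, |y i| ≤ n := by
  simp [cube, abs_le]

theorem card_cube (d n : ℕ) : (cube d n).card = (2 * n + 1) ^ d := by
  rw [cube, Fintype.card_piFinset]
  simp
  congr 1
  omega

theorem abs_nbr_le {d : ℕ} (y : Vd d) (j : Fin d × Bool) (i : Fin d) : |nbr y j i| ≤ |y i| + 1 := by
  rw [nbr_apply]
  split_ifs <;> grind

theorem nbr_mem_cube {d n : ℕ} {y : Vd d} (hy : y ∈ cube d n) (j : Fin d × Bool) :
    nbr y j ∈ cube d (n + 1) := by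
  rw [mem_cube] at *
  intro i
  have := abs_nbr_le y j i
  have := hy i
  push_cast
  omega

theorem cube_mono {d n n' : ℕ} (h : n ≤ n') : cube d n ⊆ cube d n' := by
  intro y hy
  rw [mem_cube] at *
  intro i
  have := hy i
  omega

theorem sum_mul_lapd_cube {d n : ℕ} (f u : Vd d → ℝ) (hu : ∀ y, u y ≠ 0 → y ∈ cube d n) :
    ∑ y ∈ cube d (n + 1), f y * lapd u y = ∑ y ∈ cube d (n + 1), u y * lapd f y :=
  sum_mul_lapd _ _ _ fun y hy => ⟨cube_mono (Nat.le_succ n) (hu y hy), nbr_mem_cube (hu y hy)⟩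

/-- Symmetric functions on `ℤᵈ` that decrease away from the origin along the coordinate axes and
away from the diagonals. -/
structure IsUnimodal {d : ℕ} (u : Vd d → ℝ) : Prop where
  reflect : ∀ i (y : Vd d), u (Function.update y i (-y i)) = u y
  swap : ∀ i j (y : Vd d), u (y ∘ Equiv.swap i j) = u y
  anti : ∀ i (y : Vd d), 0 ≤ y i → u (y + Pi.single i 1) ≤ u y
  transfer : ∀ i j (y : Vd d), i ≠ j → y j ≤ y i → u (y + Pi.single i 1) ≤ u (y + Pi.single j 1)

namespace IsUnimodal

variable {d : ℕ} {u : Vd d → ℝ}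

theorem apply_abs (hu : IsUnimodal u) (y : Vd d) : u (fun i => |y i|) = u y := by
  have key : ∀ s : Finset (Fin d), u (fun i => if i ∈ s then |y i| else y i) = u y := by
    intro s
    induction s using Finset.induction_on with
    | empty => simp
    | insert a s ha ih =>
      rw [← ih]
      rcases abs_choice (y a) with h | h
      · congr 1
        ext i
        by_cases hi : i = a
        · subst hi; simp [ha, h]
        · simp [hi]
      · rw [← hu.reflect a (fun i => if i ∈ s then |y i| else y i)]
        congr 1
        ext i
        by_cases hi : i = a
        · subst hi; simp [ha, h]
        · simp [hi]
  simpa using key Finset.univ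

theorem le_of_le (hu : IsUnimodal u) {y z : Vd d} (hz : ∀ i, 0 ≤ z i) (hzy : ∀ i, z i ≤ y i) :
    u y ≤ u z := by
  obtain ⟨n, hn⟩ : ∃ n : ℕ, ∑ i, (y i - z i) = n :=
    Int.eq_ofNat_of_zero_le (Finset.sum_nonneg fun i _ => sub_nonneg.2 (hzy i))
  induction n generalizing y with
  | zero =>
    have h := (Finset.sum_eq_zero_iff_of_nonneg fun i _ => sub_nonneg.2 (hzy i)).1 hn
    have : y = z := funext fun i => sub_eq_zero.1 (h i (Finset.mem_univ i))
    rw [this]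
  | succ n ih =>
    obtain ⟨i, hi⟩ : ∃ i, z i < y i := by
      by_contra! h
      have : ∑ i, (y i - z i) ≤ 0 := Finset.sum_nonpos fun i _ => sub_nonpos.2 (h i)
      omega
    have h1 := hu.anti i (y - Pi.single i 1) (by have := hz i; simp; omega)
    rw [sub_add_cancel] at h1
    refine h1.trans (ih ?_ ?_)
    · intro k
      by_cases hk : k = i
      · subst hk; simp; omega
      · simpa [hk] using hzy k
    · simp only [Pi.sub_apply, Finset.sum_sub_distrib, Finset.sum_pi_single', Finset.mem_univ,
        if_true] at hn ⊢
      push_cast at hn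
      have : ∑ x, (Pi.single i (1 : ℤ) : Vd d) x = 1 := by simp
      omega

theorem single_le_of_max (hu : IsUnimodal u) {z : Vd d} (hz : ∀ i, 0 ≤ z i) (i : Fin d)
    (hi : ∀ j, z j ≤ z i) : u (Pi.single i (∑ j, z j)) ≤ u z := by
  have hle : z i ≤ ∑ j, z j := Finset.single_le_sum (fun j _ => hz j) (Finset.mem_univ i)
  obtain ⟨n, hn⟩ : ∃ n : ℕ, ∑ j, z j - z i = n := Int.eq_ofNat_of_zero_le (by omega)
  induction n generalizing z with
  | zero =>
    have h : ∀ j, j ≠ i → z j = 0 := by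
      intro j hj
      have := Finset.add_le_sum (f := z) (s := Finset.univ) (fun k _ => hz k)
        (Finset.mem_univ i) (Finset.mem_univ j) hj.symm
      have := hz j
      push_cast at hn
      omega
    refine le_of_eq (congrArg u (funext fun j => ?_))
    by_cases hj : j = i
    · subst hj; simp; push_cast at hn; omega
    · simp [hj, h j hj]
  | succ n ih =>
    obtain ⟨j, hji, hj⟩ : ∃ j, j ≠ i ∧ 0 < z j := by
      by_contra! h
      have : ∑ j, z j = z i := Finset.sum_eq_single i
        (fun j _ hj => le_antisymm (h j hj) (hz j)) (by simp)
      push_cast at hn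
      omega
    have h1 := hu.transfer i j (z - Pi.single j 1) hji.symm
      (by have := hi j; simp [hji.symm]; omega)
    rw [sub_add_cancel] at h1
    have hsum : ∑ k, (z - Pi.single j 1 + Pi.single i 1 : Vd d) k = ∑ k, z k := by
      have e1 : ∑ x, (Pi.single i (1 : ℤ) : Vd d) x = 1 := by simp
      have e2 : ∑ x, (Pi.single j (1 : ℤ) : Vd d) x = 1 := by simp
      simp only [Pi.sub_apply, Pi.add_apply, Finset.sum_sub_distrib, Finset.sum_add_distrib]
      omega
    have hval : ∀ k, (z - Pi.single j 1 + Pi.single i 1 : Vd d) k =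
        z k - (if k = j then 1 else 0) + if k = i then 1 else 0 := by
      intro k
      simp [Pi.single_apply]
    have h2 := @ih (z - Pi.single j 1 + Pi.single i 1) ?_ ?_ ?_ ?_
    · rw [hsum] at h2
      exact h2.trans h1
    · intro k
      rw [hval]
      have := hz k
      split_ifs <;> grind
    · intro k
      rw [hval, hval]
      have := hi k
      split_ifs <;> grind
    · rw [hsum, hval, if_neg hji.symm, if_pos rfl]
      push_cast at hn
      omega
    · rw [hsum, hval, if_neg hji.symm, if_pos rfl]
      push_cast at hn
      omega

/-- A unimodal function is comparable at points whose `ℓ¹` and `ℓ^∞` norms are ordered. -/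
theorem le_of_sum_abs_le (hu : IsUnimodal u) {y z : Vd d} (i : Fin d)
    (h : ∑ j, |z j| ≤ |y i|) : u y ≤ u z := by
  have : Nonempty (Fin d) := ⟨i⟩
  obtain ⟨k, hk⟩ := Finite.exists_max fun j => |z j|
  rw [← hu.apply_abs z, ← hu.apply_abs y]
  refine le_trans ?_ (hu.single_le_of_max (fun _ => abs_nonneg _) k hk)
  have hS : 0 ≤ ∑ j, |z j| := Finset.sum_nonneg fun j _ => abs_nonneg _
  have he : (Pi.single k (∑ j, |z j|) : Vd d) ∘ Equiv.swap i k = Pi.single i (∑ j, |z j|) := by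
    ext l
    simp only [Function.comp, Pi.single_apply, Equiv.swap_apply_eq_iff, Equiv.swap_apply_right]
  rw [← hu.swap i k (Pi.single k _), he]
  refine hu.le_of_le ?_ ?_
  · intro l
    by_cases hl : l = i
    · subst hl; simpa using hS
    · simp [hl]
  · intro l
    by_cases hl : l = i
    · subst hl; simpa using h
    · simp [hl]

end IsUnimodal

theorem lapd_reflect {d : ℕ} {u : Vd d → ℝ} (hu : IsUnimodal u) (i : Fin d) (y : Vd d) :
    lapd u (Function.update y i (-y i)) = lapd u y := by
  rw [lapd_eq, lapd_eq, hu.reflect]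
  congr 1
  rw [Fintype.sum_prod_type, Fintype.sum_prod_type]
  refine Finset.sum_congr rfl fun k _ => ?_
  have key : ∀ b, u (nbr (Function.update y i (-y i)) (k, b)) =
      u (nbr y (k, if k = i then !b else b)) := by
    intro b
    rw [← hu.reflect i (nbr y (k, if k = i then !b else b))]
    congr 1
    ext l
    by_cases hl : l = i
    · subst hl
      by_cases hk : k = l
      · subst hk; cases b <;> simp [nbr_apply] <;> ring
      · simp [nbr_apply, hk, Ne.symm hk]
    · by_cases hk : k = i
      · subst hk; simp [nbr_apply, hl]
      · simp [nbr_apply, hl, hk]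
  simp only [Fintype.sum_bool, key]
  by_cases hk : k = i <;> simp [hk, add_comm]

theorem lapd_swap {d : ℕ} {u : Vd d → ℝ} (hu : IsUnimodal u) (i j : Fin d) (y : Vd d) :
    lapd u (y ∘ Equiv.swap i j) = lapd u y := by
  rw [lapd_eq, lapd_eq, hu.swap]
  congr 1
  refine Fintype.sum_equiv ((Equiv.swap i j).prodCongr (Equiv.refl Bool)) _ _ ?_
  rintro ⟨k, b⟩
  rw [← hu.swap i j (nbr y _)]
  congr 1
  ext l
  simp [nbr_apply]

/-- One damped step of the divisible sandpile obstacle problem with mass `N` at the origin. -/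
noncomputable def sandStep {d : ℕ} (N : ℝ) (u : Vd d → ℝ) (y : Vd d) : ℝ :=
  max 0 (u y + (lapd u y - 1 + if y = 0 then N else 0) / (4 * d))

theorem lazy_eq {d : ℕ} (hd : 0 < d) (u : Vd d → ℝ) (y : Vd d) :
    u y + lapd u y / (4 * d) = u y / 2 + (∑ j, u (nbr y j)) / (4 * d) := by
  have : (d : ℝ) ≠ 0 := by positivity
  rw [lapd_eq]
  field_simp
  ring

theorem sandStep_le {d : ℕ} (N : ℝ) {u v : Vd d → ℝ} {y z : Vd d}
    (h : u y + lapd u y / (4 * d) ≤ v z + lapd v z / (4 * d))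
    (h0 : (if y = 0 then N else 0) ≤ if z = 0 then N else 0) :
    sandStep N u y ≤ sandStep N v z := by
  unfold sandStep
  refine max_le_max le_rfl ?_
  have : (if y = 0 then N else 0) / (4 * d : ℝ) ≤ (if z = 0 then N else 0) / (4 * d) := by gcongr
  rw [add_div, add_div, sub_div, sub_div]
  linarith

theorem sandStep_mono {d : ℕ} (hd : 0 < d) (N : ℝ) {u v : Vd d → ℝ} (h : ∀ y, u y ≤ v y)
    (y : Vd d) : sandStep N u y ≤ sandStep N v y := by
  refine sandStep_le N ?_ le_rfl
  rw [lazy_eq hd, lazy_eq hd]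
  have := Finset.sum_le_sum fun j (_ : j ∈ Finset.univ) => h (nbr y j)
  have := h y
  gcongr

theorem IsUnimodal.sandStep {d : ℕ} (hd : 0 < d) {N : ℝ} (hN : 0 ≤ N) {u : Vd d → ℝ}
    (hu : IsUnimodal u) : IsUnimodal (sandStep N u) where
  reflect i y := by
    have : Function.update y i (-y i) = 0 ↔ y = 0 := by
      simp only [funext_iff, Pi.zero_apply]
      refine forall_congr' fun k => ?_
      by_cases hk : k = i
      · subst hk; simp
      · simp [hk]
    simp only [_root_.sandStep, hu.reflect, lapd_reflect hu, this]
  swap i j y := by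
    have : y ∘ Equiv.swap i j = 0 ↔ y = 0 := by
      simp only [funext_iff, Pi.zero_apply, Function.comp]
      exact (Equiv.swap i j).forall_congr_left.trans (by simp)
    simp only [_root_.sandStep, hu.swap, lapd_swap hu, this]
  anti i y hy := by
    refine sandStep_le N ?_ ?_
    · rw [lazy_eq hd, lazy_eq hd]
      have h0 := hu.anti i y hy
      have key : ∑ j, u (nbr (y + Pi.single i 1) j) ≤
          ∑ j, (u (nbr y j) + if j = (i, false) then u y - u (y + Pi.single i 1) else 0) := by
        refine Finset.sum_le_sum fun j _ => ?_
        by_cases hj : j = (i, false)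
        · subst hj
          have e1 : nbr (y + Pi.single i 1) (i, false) = y := by simp [nbr]
          rw [e1, if_pos rfl]
          rcases hy.eq_or_lt with h | h
          · have e2 : nbr y (i, false) = Function.update (y + Pi.single i 1) i
                (-((y + Pi.single i 1 : Vd d) i)) := by
              ext k
              by_cases hk : k = i
              · subst hk; simp [nbr, ← h]
              · simp [nbr, hk]
            rw [e2, hu.reflect]
            linarith
          · have := hu.anti i (nbr y (i, false)) (by simp [nbr]; omega)
            rw [← nbr_add, e1] at this
            linarith
        · rw [if_neg hj, add_zero, nbr_add]
          refine hu.anti i _ ?_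
          rw [nbr_apply]
          obtain ⟨k, b⟩ := j
          by_cases hk : i = k
          · subst hk
            cases b
            · simp at hj
            · simp; omega
          · simpa [hk] using hy
      rw [Finset.sum_add_distrib, Finset.sum_ite_eq' Finset.univ (i, false),
        if_pos (Finset.mem_univ _)] at key
      have hd1 : (1 : ℝ) ≤ d := by exact_mod_cast hd
      have h1 : (∑ j, u (nbr (y + Pi.single i 1) j)) / (4 * d) ≤
          ((∑ j, u (nbr y j)) + (u y - u (y + Pi.single i 1))) / (4 * d) := by gcongr
      have h2 : (u y - u (y + Pi.single i 1)) / (4 * d) ≤ (u y - u (y + Pi.single i 1)) / 2 := by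
        apply div_le_div_of_nonneg_left <;> linarith
      rw [add_div] at h1
      linarith
    · rw [if_neg]
      · split_ifs <;> simp [hN]
      · intro h
        have := congrFun h i
        simp at this
        omega
  transfer i j y hij h := by
    rcases h.lt_or_eq with h | h
    · refine sandStep_le N ?_ ?_
      · rw [lazy_eq hd, lazy_eq hd]
        have h0 := hu.transfer i j y hij h.le
        have : ∑ k, u (nbr (y + Pi.single i 1) k) ≤ ∑ k, u (nbr (y + Pi.single j 1) k) := by
          refine Finset.sum_le_sum fun k _ => ?_
          rw [nbr_add, nbr_add]
          refine hu.transfer i j _ hij ?_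
          rw [nbr_apply, nbr_apply]
          split_ifs <;> grind
        gcongr
      · rw [if_neg]
        · split_ifs <;> simp [hN]
        · intro h'
          have h1 := congrFun h' i
          have h2 := congrFun h' j
          simp [hij.symm] at h1 h2
          omega
    · have e : (y + Pi.single j 1 : Vd d) = (y + Pi.single i 1) ∘ Equiv.swap i j := by
        ext k
        by_cases hki : k = i
        · subst hki; simp [hij, hij.symm, h]
        · by_cases hkj : k = j
          · subst hkj; simp [h]
          · simp [Equiv.swap_apply_of_ne_of_ne hki hkj, hki, hkj]
      have e0 : (y + Pi.single i 1 : Vd d) ∘ Equiv.swap i j = 0 ↔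
          (y + Pi.single i 1 : Vd d) = 0 := by
        simp only [funext_iff, Pi.zero_apply, Function.comp]
        exact (Equiv.swap i j).forall_congr_left.trans (by simp)
      rw [e]
      simp only [_root_.sandStep, hu.swap, lapd_swap hu, e0, le_refl]

theorem rnorm2_nbr {d : ℕ} (y : Vd d) (i : Fin d) (b : Bool) :
    rnorm2 (nbr y (i, b)) = rnorm2 y + (if b then 2 * (y i : ℝ) else -(2 * (y i : ℝ))) + 1 := by
  have : rnorm2 (nbr y (i, b)) - rnorm2 y =
      (if b then 2 * (y i : ℝ) else -(2 * (y i : ℝ))) + 1 := by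
    unfold rnorm2
    rw [← Finset.sum_sub_distrib, Finset.sum_eq_single i]
    · cases b <;> simp [nbr_apply] <;> ring
    · intro k _ hk
      simp [nbr_apply, hk]
    · simp
  linarith

theorem lapd_const_sub_rnorm2 {d : ℕ} (c : ℝ) (y : Vd d) :
    lapd (fun y => c - rnorm2 y) y = -(2 * d) := by
  rw [lapd, Fintype.sum_prod_type]
  simp only [Fintype.sum_bool, rnorm2_nbr]
  rw [Finset.sum_congr rfl (g := fun _ => (-2 : ℝ))]
  · simp; ring
  · intro i _
    simp
    ring

/-- Nonnegative functions that the sandpile step increases. -/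
structure IsSubpile {d : ℕ} (N : ℝ) (u : Vd d → ℝ) : Prop where
  nonneg : ∀ y, 0 ≤ u y
  le_step : ∀ y, u y ≤ sandStep N u y
  unimodal : IsUnimodal u

namespace IsSubpile

variable {d : ℕ} {N : ℝ} {u : Vd d → ℝ}

theorem le_lapd (hd : 0 < d) (hN : 0 ≤ N) (hu : IsSubpile N u) (y : Vd d) :
    (if u y ≠ 0 then 1 else 0) ≤ lapd u y + if y = 0 then N else 0 := by
  by_cases hy : u y = 0
  · have : 0 ≤ lapd u y :=
      Finset.sum_nonneg fun j _ => by rw [hy, sub_zero]; exact hu.nonneg _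
    have : 0 ≤ if y = 0 then N else 0 := by split_ifs <;> simp [hN]
    simp only [hy, ne_eq, not_true_eq_false, if_false]
    linarith
  · rw [if_pos hy]
    have hpos := (hu.nonneg y).lt_of_ne' hy
    rcases le_max_iff.1 (hu.le_step y) with h | h
    · linarith
    · have h2 : 0 ≤ (lapd u y - 1 + if y = 0 then N else 0) / (4 * d) := by linarith
      have h3 : (0 : ℝ) < 4 * d := by positivity
      by_contra! hc
      have := div_neg_of_neg_of_pos
        (by linarith : (lapd u y - 1 + if y = 0 then N else 0) < 0) h3
      linarith

theorem card_support_le (hd : 0 < d) (hN : 0 ≤ N) (hu : IsSubpile N u) {n : ℕ}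
    (hn : ∀ y, u y ≠ 0 → y ∈ cube d n) (S : Finset (Vd d)) (hS : ∀ y ∈ S, u y ≠ 0) :
    (S.card : ℝ) ≤ N := by
  have h0 := sum_mul_lapd_cube (fun _ => 1) u hn
  simp only [one_mul, lapd, sub_self, Finset.sum_const_zero, mul_zero] at h0
  have h1 := Finset.sum_le_sum fun y (_ : y ∈ cube d (n + 1)) => hu.le_lapd hd hN y
  rw [Finset.sum_add_distrib] at h1
  have h2 : ∑ y ∈ cube d (n + 1), (if y = 0 then N else 0) = N := by
    rw [Finset.sum_ite_eq', if_pos]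
    rw [mem_cube]
    intro i
    simp
    omega
  have h3 : (S.card : ℝ) ≤ ∑ y ∈ cube d (n + 1), if u y ≠ 0 then 1 else 0 := by
    rw [Finset.sum_ite, Finset.sum_const_zero, add_zero, Finset.sum_const, nsmul_one]
    exact_mod_cast Finset.card_le_card fun y hy => Finset.mem_filter.2
      ⟨cube_mono (Nat.le_succ n) (hn y (hS y hy)), hS y hy⟩
  simp only [lapd] at h1
  linarith

theorem mem_cube_of_ne_zero {m : ℕ} (hd : 0 < d) (hu : IsSubpile ((2 * m + 1 : ℝ) ^ d) u)
    {n : ℕ} (hn : ∀ y, u y ≠ 0 → y ∈ cube d n) (y : Vd d) (hy : u y ≠ 0) :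
    y ∈ cube d (d * (m + 1)) := by
  rw [mem_cube]
  intro i
  by_contra! hi
  have h := hu.card_support_le hd (by positivity) hn (cube d (m + 1)) ?_
  · rw [card_cube] at h
    have : (2 * m + 1) ^ d < (2 * (m + 1) + 1) ^ d := Nat.pow_lt_pow_left (by omega) hd.ne'
    have h' : (2 * (m + 1) + 1) ^ d ≤ (2 * m + 1) ^ d := by exact_mod_cast h
    omega
  · intro z hz
    have hsum : ∑ j, |z j| ≤ |y i| := by
      refine le_trans (Finset.sum_le_sum fun j _ => mem_cube.1 hz j) ?_
      simp
      push_cast at hi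
      exact hi.le
    have := hu.unimodal.le_of_sum_abs_le i hsum
    have := (hu.nonneg y).lt_of_ne' hy
    exact (by linarith : 0 < u z).ne'

theorem sum_le (hd : 0 < d) (hN : 0 ≤ N) (hu : IsSubpile N u) {n : ℕ}
    (hn : ∀ y, u y ≠ 0 → y ∈ cube d n) :
    ∑ y ∈ cube d (n + 1), u y ≤ N * (n + 1) ^ 2 / 2 := by
  have h0 := sum_mul_lapd_cube (fun y => d * ((n : ℝ) + 1) ^ 2 - rnorm2 y) u hn
  simp only [lapd_const_sub_rnorm2] at h0
  rw [← Finset.sum_mul] at h0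
  have h1 : ∀ y ∈ cube d (n + 1), (if y = 0 then -(N * (d * ((n : ℝ) + 1) ^ 2)) else 0) ≤
      (d * ((n : ℝ) + 1) ^ 2 - rnorm2 y) * lapd u y := by
    intro y hy
    have hy' : rnorm2 y ≤ d * ((n : ℝ) + 1) ^ 2 := by
      have : rnorm2 y ≤ ∑ _i : Fin d, ((n : ℝ) + 1) ^ 2 := by
        refine Finset.sum_le_sum fun i _ => ?_
        rw [← sq_abs]
        have h := mem_cube.1 hy i
        have : |(y i : ℝ)| ≤ (n : ℝ) + 1 := by exact_mod_cast h
        gcongr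
      simpa using this
    have hl := hu.le_lapd hd hN y
    have hl' : -(if y = 0 then N else 0) ≤ lapd u y := by
      have : (0 : ℝ) ≤ if u y ≠ 0 then 1 else 0 := by split_ifs <;> norm_num
      linarith
    by_cases h : y = 0
    · subst h
      simp only [if_true] at hl' ⊢
      have : rnorm2 (0 : Vd d) = 0 := by simp [rnorm2]
      rw [this] at hy' ⊢
      nlinarith
    · rw [if_neg h] at hl' ⊢
      exact mul_nonneg (by linarith) (by linarith)
  have h2 := Finset.sum_le_sum h1
  rw [Finset.sum_ite_eq', h0] at h2
  have hd' : (0 : ℝ) < d := by exact_mod_cast hd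
  have h3 : -(N * (d * ((n : ℝ) + 1) ^ 2)) ≤ (∑ y ∈ cube d (n + 1), u y) * -(2 * d) := by
    refine le_trans ?_ h2
    split_ifs
    · exact le_rfl
    · have : 0 ≤ N * (d * ((n : ℝ) + 1) ^ 2) := by positivity
      linarith
  by_contra! h
  nlinarith

end IsSubpile

theorem isUnimodal_zero (d : ℕ) : IsUnimodal (0 : Vd d → ℝ) := by
  constructor <;> simp

theorem isSubpile_iterate {d : ℕ} (hd : 0 < d) {N : ℝ} (hN : 0 ≤ N) (n : ℕ) :
    IsSubpile N ((sandStep N)^[n] (0 : Vd d → ℝ)) := by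
  induction n with
  | zero => exact ⟨fun _ => le_rfl, fun y => le_max_left _ _, isUnimodal_zero d⟩
  | succ n ih =>
    rw [Function.iterate_succ_apply']
    exact ⟨fun y => le_max_left _ _, fun y => sandStep_mono hd N ih.le_step y,
      ih.unimodal.sandStep hd hN⟩

theorem iterate_support {d : ℕ} (N : ℝ) (n : ℕ) (y : Vd d)
    (hy : (sandStep N)^[n] (0 : Vd d → ℝ) y ≠ 0) : y ∈ cube d n := by
  induction n generalizing y with
  | zero => simp at hy
  | succ n ih =>
    by_contra hc
    apply hy
    set u := (sandStep N)^[n] (0 : Vd d → ℝ) with hu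
    have h1 : u y = 0 := by
      by_contra h
      exact hc (cube_mono (Nat.le_succ n) (ih y h))
    have h2 : ∀ j, u (nbr y j) = 0 := by
      rintro ⟨i, b⟩
      by_contra h
      have := nbr_mem_cube (ih _ h) (i, !b)
      rw [nbr_nbr_not] at this
      exact hc this
    have h3 : y ≠ 0 := by
      rintro rfl
      exact hc (mem_cube.2 fun i => by simp; omega)
    have h4 : lapd u y = 0 := by simp [lapd, h1, h2]
    rw [Function.iterate_succ_apply', ← hu, sandStep, h1, h4, if_neg h3]
    refine max_eq_left ?_
    have : (0 : ℝ) ≤ 1 / (4 * d) := by positivity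
    have e : (0 : ℝ) + (0 - 1 + 0) / (4 * d) = -(1 / (4 * d)) := by ring
    linarith

/-- The odometer of the divisible sandpile started from mass `(2m + 1)ᵈ` at the origin. -/
theorem exists_odometer {d : ℕ} (hd : 0 < d) (m : ℕ) :
    ∃ u : Vd d → ℝ, IsSubpile ((2 * m + 1 : ℝ) ^ d) u ∧ sandStep ((2 * m + 1 : ℝ) ^ d) u = u ∧
      ∀ y, u y ≠ 0 → y ∈ cube d (d * (m + 1)) := by
  set N : ℝ := (2 * m + 1 : ℝ) ^ d with hNdef
  have hN : 0 ≤ N := by positivity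
  set U : ℕ → Vd d → ℝ := fun n => (sandStep N)^[n] 0 with hU
  have hsub : ∀ n, IsSubpile N (U n) := isSubpile_iterate hd hN
  have hsucc : ∀ n, U (n + 1) = sandStep N (U n) := fun n => Function.iterate_succ_apply' _ _ _
  have hsupp : ∀ n y, U n y ≠ 0 → y ∈ cube d (d * (m + 1)) := fun n =>
    (hsub n).mem_cube_of_ne_zero hd (iterate_support N n)
  have hmono : ∀ y, Monotone fun n => U n y := fun y =>
    monotone_nat_of_le_succ fun n => by rw [hsucc]; exact (hsub n).le_step y
  have hbdd : ∀ y, BddAbove (Set.range fun n => U n y) := by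
    intro y
    refine ⟨N * ((d * (m + 1) : ℕ) + 1) ^ 2 / 2, ?_⟩
    rintro _ ⟨n, rfl⟩
    show U n y ≤ _
    by_cases hy : U n y = 0
    · rw [hy]; positivity
    · refine le_trans ?_ ((hsub n).sum_le hd hN (hsupp n))
      exact Finset.single_le_sum (fun z _ => (hsub n).nonneg z)
        (cube_mono (Nat.le_succ _) (hsupp n y hy))
  have hlim : ∀ y, Filter.Tendsto (fun n => U n y) Filter.atTop (nhds (⨆ n, U n y)) := fun y =>
    tendsto_atTop_ciSup (hmono y) (hbdd y)
  set u : Vd d → ℝ := fun y => ⨆ n, U n y with hu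
  have hfix : sandStep N u = u := by
    funext y
    refine tendsto_nhds_unique (f := fun n => U (n + 1) y) (l := Filter.atTop) ?_
      ((hlim y).comp (Filter.tendsto_add_atTop_nat 1))
    simp only [hsucc, sandStep, lapd]
    refine tendsto_const_nhds.max ((hlim y).add (Filter.Tendsto.div_const ?_ _))
    exact ((tendsto_finsetSum _ fun j _ => (hlim _).sub (hlim y)).sub_const 1).add_const _
  refine ⟨u, ⟨fun y => ?_, fun y => (congrFun hfix y).ge, ?_⟩, hfix, ?_⟩
  · exact ge_of_tendsto' (hlim y) fun n => (hsub n).nonneg y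
  · constructor
    · intro i y
      simp only [hu, (hsub _).unimodal.reflect]
    · intro i j y
      simp only [hu, (hsub _).unimodal.swap]
    · intro i y hy
      exact le_of_tendsto_of_tendsto' (hlim _) (hlim _) fun n => (hsub n).unimodal.anti i y hy
    · intro i j y hij hy
      exact le_of_tendsto_of_tendsto' (hlim _) (hlim _) fun n =>
        (hsub n).unimodal.transfer i j y hij hy
  · intro y hy
    by_contra h
    apply hy
    have : ∀ n, U n y = 0 := fun n => by
      by_contra h'
      exact h (hsupp n y h')
    simp [hu, this]

theorem lapd_le_of_sandStep_eq {d : ℕ} (hd : 0 < d) {N : ℝ} {u : Vd d → ℝ}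
    (h : sandStep N u = u) (y : Vd d) : lapd u y ≤ 1 - if y = 0 then N else 0 := by
  have h1 : u y + (lapd u y - 1 + if y = 0 then N else 0) / (4 * d) ≤ u y :=
    (le_max_right _ _).trans (congrFun h y).le
  have h3 : (0 : ℝ) < 4 * d := by positivity
  by_contra! hc
  have := div_pos (by linarith : 0 < lapd u y - 1 + if y = 0 then N else 0) h3
  linarith

theorem ne_zero_of_sum_abs_lt {d : ℕ} (hd : 0 < d) {m : ℕ} {u : Vd d → ℝ}
    (hu : IsSubpile ((2 * m + 1 : ℝ) ^ d) u) (hfix : sandStep ((2 * m + 1 : ℝ) ^ d) u = u)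
    {z : Vd d} (hz : ∑ i, |z i| < m) : u z ≠ 0 := by
  intro h0
  have hm : 1 ≤ m := by
    have : 0 ≤ ∑ i, |z i| := Finset.sum_nonneg fun i _ => abs_nonneg _
    omega
  have hsupp : ∀ y, u y ≠ 0 → ∀ i, |y i| + 1 ≤ ((m - 1 : ℕ) : ℤ) := by
    intro y hy i
    by_contra! hc
    have := hu.unimodal.le_of_sum_abs_le (z := z) (y := y) i (by omega)
    have := (hu.nonneg y).lt_of_ne' hy
    linarith
  have h1 := sum_mul_lapd (cube d (m - 1)) (fun _ => 1) u ?_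
  · have h2 := Finset.sum_le_sum fun y (_ : y ∈ cube d (m - 1)) => lapd_le_of_sandStep_eq hd hfix y
    have hmem : (0 : Vd d) ∈ cube d (m - 1) := mem_cube.2 fun i => by simp
    rw [Finset.sum_sub_distrib, Finset.sum_ite_eq', if_pos hmem] at h2
    have h3 : ∑ y ∈ cube d (m - 1), lapd u y = 0 := by
      simpa [lapd] using h1
    rw [h3] at h2
    simp only [Finset.sum_const, card_cube, nsmul_one] at h2
    have h4 : (2 * (m - 1) + 1) ^ d < (2 * m + 1) ^ d := Nat.pow_lt_pow_left (by omega) hd.ne'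
    have h5 : (((2 * (m - 1) + 1) ^ d : ℕ) : ℝ) < (2 * m + 1 : ℝ) ^ d := by exact_mod_cast h4
    linarith
  · intro y hy
    refine ⟨mem_cube.2 fun i => ?_, fun j => mem_cube.2 fun i => ?_⟩
    · have := hsupp y hy i
      omega
    · have := hsupp y hy i
      have := abs_nbr_le y j i
      omega

theorem abs_sum_mul_lapd_le {d : ℕ} (hd : 0 < d) {N : ℝ} (hN : 0 ≤ N) {u : Vd d → ℝ}
    (hu : IsSubpile N u) {n : ℕ} (hn : ∀ y, u y ≠ 0 → y ∈ cube d n) {g : Vd d → ℝ}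
    (hg : ∀ y ∈ cube d n, |lapd g y| ≤ 1) :
    |∑ y ∈ cube d (n + 1), g y * lapd u y| ≤ N * (n + 1) ^ 2 / 2 := by
  rw [sum_mul_lapd_cube g u hn]
  refine (Finset.abs_sum_le_sum_abs _ _).trans (le_trans ?_ (hu.sum_le hd hN hn))
  refine Finset.sum_le_sum fun y _ => ?_
  by_cases hy : u y = 0
  · simp [hy]
  · rw [abs_mul, abs_of_nonneg (hu.nonneg y)]
    exact mul_le_of_le_one_right (hu.nonneg y) (hg y (hn y hy))

theorem zero_mem_cube (d n : ℕ) : (0 : Vd d) ∈ cube d n := mem_cube.2 fun i => by simp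

/-- A nonnegative function with bounded Laplacian has bounded mass around the origin. -/
theorem sum_le_of_abs_lapd_le {d : ℕ} (hd : 0 < d) (m : ℕ) {g : Vd d → ℝ} (hg0 : ∀ y, 0 ≤ g y)
    (hg : ∀ y ∈ cube d (d * (m + 1)), |lapd g y| ≤ 1) (S : Finset (Vd d))
    (hS : ∀ z ∈ S, ∑ i, |z i| < m) :
    ∑ y ∈ S, g y ≤ (2 * m + 1 : ℝ) ^ d * (g 0 + ((d * (m + 1) : ℕ) + 1 : ℝ) ^ 2 / 2) := by
  obtain ⟨u, hu, hfix, hsupp⟩ := exists_odometer hd m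
  have hN : (0 : ℝ) ≤ (2 * m + 1 : ℝ) ^ d := by positivity
  have h1 := (abs_le.1 (abs_sum_mul_lapd_le hd hN hu hsupp hg)).2
  have h2 : ∑ y ∈ cube d (d * (m + 1) + 1), ((if u y ≠ 0 then g y else 0) -
      if y = 0 then (2 * m + 1 : ℝ) ^ d * g y else 0) ≤
      ∑ y ∈ cube d (d * (m + 1) + 1), g y * lapd u y := by
    refine Finset.sum_le_sum fun y _ => ?_
    have := mul_le_mul_of_nonneg_left (hu.le_lapd hd hN y) (hg0 y)
    split_ifs at this ⊢ <;> linarith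
  rw [Finset.sum_sub_distrib, Finset.sum_ite_eq', if_pos (zero_mem_cube _ _),
    ← Finset.sum_filter] at h2
  have h3 : ∑ y ∈ S, g y ≤ ∑ y ∈ cube d (d * (m + 1) + 1) with u y ≠ 0, g y := by
    refine Finset.sum_le_sum_of_subset_of_nonneg (fun y hy => ?_) fun y _ _ => hg0 y
    have := ne_zero_of_sum_abs_lt hd hu hfix (hS y hy)
    exact Finset.mem_filter.2 ⟨cube_mono (Nat.le_succ _) (hsupp y this), this⟩
  linarith

/-- A function with bounded Laplacian is bounded by its mass around the origin. -/
theorem le_sum_of_abs_lapd_le {d : ℕ} (hd : 0 < d) (m : ℕ) {g : Vd d → ℝ} (hg0 : ∀ y, 0 ≤ g y)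
    (hg : ∀ y ∈ cube d (d * (m + 1)), |lapd g y| ≤ 1) :
    (2 * m + 1 : ℝ) ^ d * g 0 ≤ ∑ y ∈ cube d (d * (m + 1) + 1), g y +
      (2 * m + 1 : ℝ) ^ d * ((d * (m + 1) : ℕ) + 1 : ℝ) ^ 2 / 2 := by
  obtain ⟨u, hu, hfix, hsupp⟩ := exists_odometer hd m
  have hN : (0 : ℝ) ≤ (2 * m + 1 : ℝ) ^ d := by positivity
  have h1 := (abs_le.1 (abs_sum_mul_lapd_le hd hN hu hsupp hg)).1
  have h2 : ∑ y ∈ cube d (d * (m + 1) + 1), g y * lapd u y ≤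
      ∑ y ∈ cube d (d * (m + 1) + 1), (g y - if y = 0 then (2 * m + 1 : ℝ) ^ d * g y else 0) := by
    refine Finset.sum_le_sum fun y _ => ?_
    have := mul_le_mul_of_nonneg_left (lapd_le_of_sandStep_eq hd hfix y) (hg0 y)
    split_ifs at this ⊢ <;> linarith
  rw [Finset.sum_sub_distrib, Finset.sum_ite_eq', if_pos (zero_mem_cube _ _)] at h2
  linarith

/-- A Harnack inequality for nonnegative functions with bounded Laplacian. -/
theorem harnack {d : ℕ} (hd : 0 < d) :
    ∃ (C : ℝ) (b : ℕ), 1 ≤ C ∧ ∀ m : ℕ, 1 ≤ m → ∀ g : Vd d → ℝ, (∀ y, 0 ≤ g y) →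
      (∀ y ∈ cube d (b * m), |lapd g y| ≤ 1) →
      ∀ x ∈ cube d m, g x ≤ C * (g 0 + m ^ 2) := by
  set a : ℕ := 2 * d + 2 * d * d + 1 with ha
  set b : ℕ := d * (a + 1) + 1 with hb
  set c : ℝ := (2 * a + 1 : ℝ) ^ d with hc
  have hc1 : 1 ≤ c := one_le_pow₀ (by have : (0 : ℝ) ≤ a := by positivity
                                      linarith)
  refine ⟨c + (c + 1) * b ^ 2, b, by nlinarith [sq_nonneg (b : ℝ)], ?_⟩
  intro m hm g hg0 hg x hx
  set K : ℕ := d * (m + 1) with hK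
  set m₁ : ℕ := d * (m + K + 1) + 1 with hm₁
  have hm₁a : m₁ ≤ a * m := by
    have hK2 : K ≤ d * (2 * m) := Nat.mul_le_mul_left _ (by omega)
    have : d * (m + K + 1) ≤ d * (m + d * (2 * m) + m) := by gcongr
    calc m₁ ≤ d * (m + d * (2 * m) + m) + m := by omega
      _ = a * m := by rw [ha]; ring
  have hK₁ : d * (m₁ + 1) + 1 ≤ b * m := by
    calc d * (m₁ + 1) + 1 ≤ d * (a * m + m) + m := by gcongr
      _ = b * m := by rw [hb]; ring
  have hKm₁ : m + K + 1 ≤ m₁ := by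
    have : 1 * (m + K + 1) ≤ d * (m + K + 1) := Nat.mul_le_mul_right _ hd
    omega
  have hm₁K₁ : m₁ + 1 ≤ d * (m₁ + 1) := Nat.le_mul_of_pos_left _ hd
  have hx' := mem_cube.1 hx
  have hup := le_sum_of_abs_lapd_le hd m (g := fun y => g (y + x)) (fun y => hg0 _) (by
    intro y hy
    rw [lapd_translate]
    refine hg _ (mem_cube.2 fun i => ?_)
    have h1 := mem_cube.1 hy i
    have h2 := hx' i
    have h3 := abs_add_le (y i) (x i)
    have h4 : m + K ≤ b * m := by omega
    simp only [Pi.add_apply]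
    zify at h4 hK
    omega)
  have hlow := sum_le_of_abs_lapd_le hd m₁ hg0
    (fun y hy => hg y (cube_mono (by omega) hy))
    ((cube d (K + 1)).map (addRightEmbedding x)) (by
      intro z hz
      obtain ⟨y, hy, rfl⟩ := Finset.mem_map.1 hz
      have : ∑ i, |(addRightEmbedding x y) i| ≤ ∑ _i : Fin d, ((m + K + 1 : ℕ) : ℤ) := by
        refine Finset.sum_le_sum fun i _ => ?_
        have h1 := mem_cube.1 hy i
        have h2 := hx' i
        have h3 := abs_add_le (y i) (x i)
        simp only [addRightEmbedding_apply, Pi.add_apply]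
        omega
      refine lt_of_le_of_lt this ?_
      rw [hm₁]
      simp)
  rw [Finset.sum_map] at hlow
  simp only [addRightEmbedding_apply, zero_add] at hlow hup
  have hm0 : (0 : ℝ) < m := by exact_mod_cast hm
  set N : ℝ := (2 * m + 1 : ℝ) ^ d with hN
  have hNpos : 0 < N := by positivity
  have hN₁ : (2 * m₁ + 1 : ℝ) ^ d ≤ c * N := by
    rw [hc, hN, ← mul_pow]
    have h1 : (m₁ : ℝ) ≤ a * m := by exact_mod_cast hm₁a
    have h2 : (0 : ℝ) ≤ a := by positivity
    gcongr
    nlinarith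
  have hK₁' : ((d * (m₁ + 1) : ℕ) + 1 : ℝ) ≤ b * m := by exact_mod_cast hK₁
  have hK' : ((K : ℕ) + 1 : ℝ) ≤ b * m := by
    have : K + 1 ≤ b * m := by omega
    exact_mod_cast this
  have e1 : ((d * (m₁ + 1) : ℕ) + 1 : ℝ) ^ 2 ≤ (b * m) ^ 2 := by gcongr
  have e2 : ((K : ℕ) + 1 : ℝ) ^ 2 ≤ (b * m) ^ 2 := by gcongr
  have e3 : (2 * m₁ + 1 : ℝ) ^ d * (g 0 + ((d * (m₁ + 1) : ℕ) + 1 : ℝ) ^ 2 / 2) ≤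
      c * N * (g 0 + (b * m) ^ 2 / 2) := by
    have := hg0 0
    gcongr
  have e4 : N * ((K : ℕ) + 1 : ℝ) ^ 2 / 2 ≤ N * (b * m) ^ 2 / 2 := by gcongr
  have e5 : N * g x ≤ N * (c * (g 0 + (b * m) ^ 2 / 2) + (b * m) ^ 2 / 2) := by
    calc N * g x ≤ c * N * (g 0 + (b * m) ^ 2 / 2) + N * (b * m) ^ 2 / 2 := by linarith
      _ = _ := by ring
  have e6 := le_of_mul_le_mul_left e5 hNpos
  refine e6.trans ?_
  have p1 : 0 ≤ (c + 1) * b ^ 2 * g 0 := by have := hg0 0; positivity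
  have p2 : 0 ≤ (c + 1) * b ^ 2 * (m : ℝ) ^ 2 := by positivity
  have p3 : 0 ≤ c * (m : ℝ) ^ 2 := by positivity
  nlinarith

theorem rnorm2_le_of_abs_le {d : ℕ} {y z : Vd d} (h : ∀ i, |y i| ≤ |z i|) :
    rnorm2 y ≤ rnorm2 z := by
  refine Finset.sum_le_sum fun i _ => sq_le_sq.2 ?_
  exact_mod_cast h i

theorem apply_nbr_le {d : ℕ} {f : Vd d → ℝ} (hf : ∀ y, 0 ≤ f y) {z : Vd d} (hz : |lapd f z| ≤ 1)
    (j : Fin d × Bool) : f (nbr z j) ≤ 1 + 2 * d * f z := by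
  have h1 := Finset.single_le_sum (f := fun j => f (nbr z j)) (fun j _ => hf _) (Finset.mem_univ j)
  have h2 := (abs_le.1 hz).2
  rw [lapd_eq] at h2
  linarith

/-- Growth bound obtained by moving one lattice step at a time. -/
theorem le_pow_of_sum_abs_le {d : ℕ} {f : Vd d → ℝ} (hf : ∀ y, 0 ≤ f y) (h0 : f 0 = 0) {x : Vd d}
    (hx : ∀ z : Vd d, (∀ i, |z i| ≤ |x i|) → |lapd f z| ≤ 1) (n : ℕ) (z : Vd d)
    (hz : ∀ i, |z i| ≤ |x i|) (hn : ∑ i, |z i| ≤ n) : f z ≤ (2 * d + 1 : ℝ) ^ n := by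
  induction n generalizing z with
  | zero =>
    have h : ∀ i, z i = 0 := fun i => by
      have := Finset.single_le_sum (f := fun i => |z i|) (fun i _ => abs_nonneg _)
        (Finset.mem_univ i)
      have := abs_nonneg (z i)
      push_cast at hn
      exact abs_eq_zero.1 (by omega)
    rw [show z = 0 from funext h, h0]
    positivity
  | succ n ih =>
    have h1 : (1 : ℝ) ≤ (2 * d + 1 : ℝ) ^ n :=
      one_le_pow₀ (by have : (0 : ℝ) ≤ d := by positivity
                      linarith)
    by_cases hz0 : z = 0
    · rw [hz0, h0]
      positivity
    · obtain ⟨i, hi⟩ := Function.ne_iff.1 hz0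
      have hi' : z i ≠ 0 := hi
      set b : Bool := decide (z i < 0) with hb
      have hv : ∀ k, |nbr z (i, b) k| = |z k| - if k = i then 1 else 0 := by
        intro k
        rw [nbr_apply]
        by_cases hk : k = i
        · subst hk
          by_cases hneg : z k < 0
          · simp only [hb, hneg, if_true, decide_true]
            rw [abs_of_neg hneg, abs_of_nonpos (by omega)]
            ring
          · simp only [hb, hneg, if_true, decide_false, Bool.false_eq_true, if_false]
            rw [abs_of_nonneg (by omega), abs_of_nonneg (by omega)]
            ring
        · simp [hk]
      have hle : ∀ k, |nbr z (i, b) k| ≤ |x k| := fun k => by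
        have := hz k
        rw [hv]
        split_ifs <;> omega
      have h2 := ih (nbr z (i, b)) hle (by
        simp only [hv, Finset.sum_sub_distrib, Finset.sum_ite_eq', Finset.mem_univ, if_true]
        push_cast at hn
        omega)
      have h3 := apply_nbr_le hf (hx _ hle) (i, !b)
      rw [nbr_nbr_not] at h3
      have : 2 * d * f (nbr z (i, b)) ≤ 2 * d * (2 * d + 1 : ℝ) ^ n := by gcongr
      rw [pow_succ]
      linarith

/-- Growth bound obtained by chaining a Harnack inequality at scale `m`. -/
theorem le_pow_mul_of_chain {d : ℕ} {f : Vd d → ℝ} (h0 : f 0 = 0) {C : ℝ} (hC : 1 ≤ C)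
    {m : ℕ} {x : Vd d}
    (hstep : ∀ z : Vd d, (∀ i, |z i| ≤ |x i|) → ∀ y ∈ cube d m, f (y + z) ≤ C * (f z + m ^ 2))
    (n : ℕ) (z : Vd d) (hz : ∀ i, |z i| ≤ |x i|) (hn : ∀ i, |z i| ≤ n * m) :
    f z ≤ (2 * C) ^ n * m ^ 2 := by
  induction n generalizing z with
  | zero =>
    have h : ∀ i, z i = 0 := fun i => by
      have := hn i
      rw [Nat.cast_zero, zero_mul] at this
      exact abs_nonpos_iff.1 this
    rw [show z = 0 from funext h, h0]
    positivity
  | succ n ih =>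
    set y : Vd d := fun i => max (-(m : ℤ)) (min m (z i)) with hy
    have hle : ∀ i, |(z - y) i| ≤ |z i| := fun i => by
      simp only [Pi.sub_apply, hy]
      grind
    have h1 := ih (z - y) (fun i => (hle i).trans (hz i)) (fun i => by
      have := hn i
      push_cast at this
      rw [add_mul, one_mul] at this
      have hnm : (0 : ℤ) ≤ n * m := by positivity
      simp only [Pi.sub_apply, hy]
      generalize (n * m : ℤ) = t at *
      grind)
    have h2 := hstep (z - y) (fun i => (hle i).trans (hz i)) y (mem_cube.2 fun i => by
      simp only [hy]
      grind)
    rw [add_sub_cancel] at h2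
    have h3 : (1 : ℝ) ≤ (2 * C) ^ n := one_le_pow₀ (by linarith)
    have h4 : (m : ℝ) ^ 2 ≤ (2 * C) ^ n * m ^ 2 := le_mul_of_one_le_left (by positivity) h3
    calc f z ≤ C * (f (z - y) + m ^ 2) := h2
      _ ≤ C * ((2 * C) ^ n * m ^ 2 + (2 * C) ^ n * m ^ 2) := by gcongr
      _ = (2 * C) ^ (n + 1) * m ^ 2 := by ring

/-- If `f : ℤᵈ → ℝ` is nonnegative with `f(0) = 0` and `|Δf| ≤ 1` on the lattice ball of
radius `2r` (`r > 1`), then `f(x) ≤ A₀|x|²` for `|x| ≤ r`, where `A₀ = A₀(d)`. -/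
theorem quadratic_growth (d : ℕ) (hd : 0 < d) :
    ∃ A₀ : ℝ, ∀ r : ℝ, 1 < r → ∀ f : Vd d → ℝ,
      (∀ v, 0 ≤ f v) → f 0 = 0 →
      (∀ v : Vd d, rnorm2 v < (2 * r) ^ 2 → |lapd f v| ≤ 1) →
      ∀ x : Vd d, rnorm2 x ≤ r ^ 2 → f x ≤ A₀ * rnorm2 x := by
  obtain ⟨C, b, hC, hH⟩ := harnack hd
  refine ⟨(2 * C) ^ (2 * (d * b + 1)) + (2 * d + 1 : ℝ) ^ (d * (d * b + 1)), ?_⟩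
  intro r hr f hf h0 hlap x hx
  have : Nonempty (Fin d) := ⟨⟨0, hd⟩⟩
  obtain ⟨k, hk⟩ := Finite.exists_max fun i => |x i|
  obtain ⟨n, hn⟩ := Int.eq_ofNat_of_zero_le (abs_nonneg (x k))
  rw [hn] at hk
  have hnx : (n : ℝ) ^ 2 ≤ rnorm2 x := by
    have h1 := Finset.single_le_sum (f := fun i => (x i : ℝ) ^ 2) (fun i _ => sq_nonneg _)
      (Finset.mem_univ k)
    have h2 : (n : ℝ) = |(x k : ℝ)| := by exact_mod_cast hn.symm
    rw [h2, sq_abs]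
    exact h1
  rcases Nat.eq_zero_or_pos n with rfl | hnpos
  · have hx0 : x = 0 := funext fun i => abs_nonpos_iff.1 (by simpa using hk i)
    rw [hx0, h0]
    simp [rnorm2]
  have hn1 : (1 : ℝ) ≤ n := by exact_mod_cast hnpos
  have hq1 : 1 ≤ rnorm2 x := by nlinarith
  set t : ℝ := (2 * C) ^ (2 * (d * b + 1)) with ht
  set s : ℝ := (2 * d + 1 : ℝ) ^ (d * (d * b + 1)) with hs
  have ht0 : 0 ≤ t := by positivity
  have hs0 : 0 ≤ s := by positivity
  have hq0 : 0 ≤ rnorm2 x := by linarith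
  obtain ⟨m, hm⟩ : ∃ m, m = n / (d * b + 1) := ⟨_, rfl⟩
  rcases Nat.eq_zero_or_pos m with hm0 | hmpos
  · have hlt : n < d * b + 1 := by
      rw [hm0] at hm
      exact (Nat.div_eq_zero_iff.1 hm.symm).resolve_left (by omega)
    have h := le_pow_of_sum_abs_le hf h0 (x := x)
      (fun z hz => hlap z (by have := rnorm2_le_of_abs_le hz; nlinarith)) (d * (d * b + 1)) x
      (fun _ => le_rfl) (by
        refine (Finset.sum_le_sum fun i _ => hk i).trans ?_
        simp only [Finset.sum_const, Finset.card_univ, Fintype.card_fin, nsmul_eq_mul]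
        have : d * n ≤ d * (d * b + 1) := Nat.mul_le_mul_left _ hlt.le
        exact_mod_cast this)
    nlinarith [mul_nonneg ht0 hq0, mul_nonneg hs0 (sub_nonneg.2 hq1)]
  · have hmn : m * (d * b + 1) ≤ n := by rw [hm]; exact Nat.div_mul_le_self _ _
    have hnm : n < (m + 1) * (d * b + 1) := by
      rw [hm, mul_comm]; exact Nat.lt_mul_div_succ n (by omega)
    have hm1 : (1 : ℝ) ≤ m := by exact_mod_cast hmpos
    have hsmall : d * ((b * m : ℕ) : ℝ) ^ 2 < rnorm2 x := by
      refine lt_of_lt_of_le ?_ hnx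
      have h1 : (d : ℝ) * b * m + m ≤ n := by
        have : d * b * m + m ≤ n := by linarith
        exact_mod_cast this
      have h2 : (1 : ℝ) ≤ d := by exact_mod_cast hd
      have h3 : (d : ℝ) * b * m < n := by linarith
      have h4 : (0 : ℝ) ≤ d * b * m := by positivity
      calc d * ((b * m : ℕ) : ℝ) ^ 2 = 1 * (d * (b * m) ^ 2 : ℝ) := by push_cast; ring
        _ ≤ d * (d * (b * m) ^ 2 : ℝ) := by gcongr
        _ = (d * b * m : ℝ) ^ 2 := by ring
        _ < n ^ 2 := by gcongr
    have h := le_pow_mul_of_chain (m := m) (x := x) h0 hC ?_ (2 * (d * b + 1)) x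
      (fun _ => le_rfl) (fun i => ?_)
    · have hmq : (m : ℝ) ^ 2 ≤ rnorm2 x := by
        refine le_trans ?_ hnx
        have : m ≤ n := by rw [hm]; exact Nat.div_le_self _ _
        gcongr
      have : t * (m : ℝ) ^ 2 ≤ t * rnorm2 x := by gcongr
      nlinarith [mul_nonneg hs0 hq0]
    · intro z hz y hy
      have h := hH m hmpos (fun y => f (y + z)) (fun y => hf _) ?_ y hy
      · simpa using h
      · intro v hv
        rw [lapd_translate]
        refine hlap _ ?_
        have h1 : rnorm2 (v + z) ≤ 2 * rnorm2 v + 2 * rnorm2 z := by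
          simp only [rnorm2, Finset.mul_sum]
          rw [← Finset.sum_add_distrib]
          refine Finset.sum_le_sum fun i _ => ?_
          simp only [Pi.add_apply, Int.cast_add]
          nlinarith [sq_nonneg ((v i : ℝ) - z i)]
        have h2 : rnorm2 v ≤ d * ((b * m : ℕ) : ℝ) ^ 2 := by
          have : rnorm2 v ≤ ∑ _i : Fin d, ((b * m : ℕ) : ℝ) ^ 2 := by
            refine Finset.sum_le_sum fun i _ => ?_
            rw [← sq_abs]
            have h := mem_cube.1 hv i
            have : |(v i : ℝ)| ≤ ((b * m : ℕ) : ℝ) := by exact_mod_cast h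
            gcongr
          simpa using this
        have h3 := rnorm2_le_of_abs_le hz
        nlinarith
    · refine (hk i).trans ?_
      have : n ≤ 2 * (d * b + 1) * m := by nlinarith
      exact_mod_cast this
end
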